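/- Let X be a regular curve, f : X → X a monotone continuous map, and (G_n)_{n ≥ 0} a sequence of nonempty compact subsets of X with diam(G_n) → 0 and f(G_{n+1}) ⊆ G_n for every n ≥ 0. Then limsup G_n = ⋂_{k ≥ 0} closure(⋃_{n ≥ k} G_n) is a minimal set of f. -/

import Mathlib

open Set Filter Metric Topology Function

/-- A regular curve: every point has arbitrarily small open neighborhoods
with finite topological boundary (to be used on a compact connected
nonempty metric space, i.e. a continuum). -/
def IsRegCurve (X : Type*) [TopologicalSpace X] : Prop :=
  ∀ (x : X) (V : Set X), IsOpen V → x ∈ V →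
    ∃ U : Set X, IsOpen U ∧ x ∈ U ∧ U ⊆ V ∧ (frontier U).Finite

/-- A monotone continuous self-map: continuous and preimages of connected
sets are connected. -/
def IsMonotoneMap {X : Type*} [TopologicalSpace X] (f : X → X) : Prop :=
  Continuous f ∧ ∀ C : Set X, IsPreconnected C → IsPreconnected (f ⁻¹' C)

/-- The ω-limit set of a point: ⋂ₙ closure {f^k(x) : k ≥ n}. -/
def omegaLimitSet {X : Type*} [TopologicalSpace X] (f : X → X) (x : X) : Set X :=
  ⋂ n : ℕ, closure ((fun k => f^[k] x) '' Set.Ici n)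

/-- The α-limit set of a point: ⋂ₖ closure (⋃_{n ≥ k} f⁻ⁿ({x})). -/
def alphaLimitSet {X : Type*} [TopologicalSpace X] (f : X → X) (x : X) : Set X :=
  ⋂ k : ℕ, closure (⋃ n ∈ Set.Ici k, f^[n] ⁻¹' {x})

/-- limsup of a sequence of sets: ⋂ₖ closure (⋃_{n ≥ k} G n). -/
def limsupSet {X : Type*} [TopologicalSpace X] (G : ℕ → Set X) : Set X :=
  ⋂ k : ℕ, closure (⋃ n ∈ Set.Ici k, G n)

/-- A minimal set of `f`: nonempty, closed, invariant, and with no proper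
nonempty closed invariant subset. -/
def IsMinimalSet {X : Type*} [TopologicalSpace X] (f : X → X) (M : Set X) : Prop :=
  M.Nonempty ∧ IsClosed M ∧ f '' M ⊆ M ∧
    ∀ A : Set X, A ⊆ M → A.Nonempty → IsClosed A → f '' A ⊆ A → A = M

/-- A periodic point of `f`. -/
def IsPeriodicPoint {X : Type*} (f : X → X) (x : X) : Prop :=
  ∃ n : ℕ, 1 ≤ n ∧ f^[n] x = x

/-- The set of limit (cluster) points of a sequence. -/
def seqLimitPoints {X : Type*} [TopologicalSpace X] (u : ℕ → X) : Set X :=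
  {y : X | MapClusterPt y Filter.atTop u}

lemma aux_cross {X : Type*} [TopologicalSpace X] {C V : Set X} (hC : IsPreconnected C)
    (h1 : (C ∩ V).Nonempty) (h2 : (C ∩ Vᶜ).Nonempty) : ∃ w ∈ C, w ∈ frontier V := by
  by_contra! h
  obtain ⟨a, haC, haV⟩ := h1
  obtain ⟨b, hbC, hbV⟩ := h2
  have key : ∀ w ∈ C, w ∈ closure V → w ∈ interior V := fun w hw hc => by
    by_contra hi; exact h w hw ⟨hc, hi⟩
  obtain ⟨w, hw, hw1, hw2⟩ := hC (interior V) (closure V)ᶜ isOpen_interior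
    isClosed_closure.isOpen_compl
    (fun w hw => by
      by_cases hc : w ∈ closure V
      · exact Or.inl (key w hw hc)
      · exact Or.inr hc)
    ⟨a, haC, key a haC (subset_closure haV)⟩
    ⟨b, hbC, fun hc => hbV (interior_subset (key b hbC hc))⟩
  exact hw2 (interior_subset_closure hw1)

lemma aux_small {X : Type*} [MetricSpace X] (hX : IsRegCurve X) {y : X} {O : Set X}
    (hO : O ∈ 𝓝 y) : ∃ U, IsOpen U ∧ y ∈ U ∧ closure U ⊆ O ∧ (frontier U).Finite := by
  obtain ⟨W, hW, hWc, hWO⟩ := exists_mem_nhds_isClosed_subset hO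
  obtain ⟨U, h1, h2, h3, h4⟩ := hX y (interior W) isOpen_interior (mem_interior_iff_mem_nhds.2 hW)
  exact ⟨U, h1, h2, (closure_minimal (h3.trans interior_subset) hWc).trans hWO, h4⟩

lemma aux_locconn {X : Type*} [MetricSpace X] [CompactSpace X] [ConnectedSpace X]
    (hX : IsRegCurve X) {y : X} {O : Set X} (hO : O ∈ 𝓝 y) :
    ∃ C, IsPreconnected C ∧ C ∈ 𝓝 y ∧ C ⊆ O := by
  obtain ⟨U, hU, hyU, hUO, hfin⟩ := aux_small hX hO
  rcases (frontier U).eq_empty_or_nonempty with h0 | ⟨b0, hb0⟩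
  · have : U = univ := IsClopen.eq_univ (isClopen_iff_frontier_eq_empty.2 h0) ⟨y, hyU⟩
    subst this
    exact ⟨univ, isPreconnected_univ, univ_mem, by simpa using hUO⟩
  have hKc : IsClosed (closure U) := isClosed_closure
  have : CompactSpace (closure U) := isCompact_iff_compactSpace.1 hKc.isCompact
  have hF : ((Subtype.val : closure U → X) ⁻¹' frontier U).Finite :=
    hfin.preimage Subtype.val_injective.injOn
  have key : ∀ w : closure U, ∃ b : closure U, (b : X) ∈ frontier U ∧ b ∈ connectedComponent w := by
    intro w
    by_contra! h
    have : ∀ b : closure U, ∃ Q : Set (closure U), IsClopen Q ∧ w ∈ Q ∧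
        ((b : X) ∈ frontier U → b ∉ Q) := by
      intro b
      by_cases hb : (b : X) ∈ frontier U
      · have := h b hb
        rw [connectedComponent_eq_iInter_isClopen] at this
        simp only [mem_iInter, not_forall] at this
        obtain ⟨⟨Q, hQ⟩, hbQ⟩ := this
        exact ⟨Q, hQ.1, hQ.2, fun _ => hbQ⟩
      · exact ⟨univ, isClopen_univ, mem_univ _, fun h => (hb h).elim⟩
    choose Q hQ hwQ hbQ using this
    set R := ⋂ b ∈ ((Subtype.val : closure U → X) ⁻¹' frontier U), Q b with hR
    have hRc : IsClopen R := hF.isClopen_biInter (fun b _ => hQ b)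
    have hRF : ∀ b ∈ R, (b : X) ∉ frontier U := fun b hb hbf => by
      have := mem_iInter₂.1 hb b hbf
      exact hbQ b hbf this
    have hRU : ∀ b ∈ R, (b : X) ∈ U := fun b hb => by
      by_contra hbU
      exact hRF b hb ⟨b.2, by rwa [hU.interior_eq]⟩
    have hcl : IsClosed (Subtype.val '' R) := hKc.isClosedEmbedding_subtypeVal.isClosedMap _ hRc.1
    obtain ⟨O', hO', hO'R⟩ := isOpen_induced_iff.1 hRc.2
    have hop : Subtype.val '' R = O' ∩ U := by
      ext p
      constructor
      · rintro ⟨b, hb, rfl⟩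
        refine ⟨?_, hRU b hb⟩
        rw [← hO'R] at hb; exact hb
      · rintro ⟨hp, hpU⟩
        refine ⟨⟨p, subset_closure hpU⟩, ?_, rfl⟩
        rw [← hO'R]; exact hp
    have hclop : IsClopen (Subtype.val '' R) := ⟨hcl, hop ▸ hO'.inter hU⟩
    have huniv := hclop.eq_univ ⟨w, w, mem_iInter₂.2 (fun b _ => hwQ b), rfl⟩
    have : b0 ∈ Subtype.val '' R := huniv ▸ mem_univ _
    obtain ⟨b, hb, hbb⟩ := this
    exact hRF b hb (hbb ▸ hb0)
  set yy : closure U := ⟨y, subset_closure hyU⟩ with hyy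
  refine ⟨Subtype.val '' connectedComponent yy, ?_, ?_, ?_⟩
  · exact isPreconnected_connectedComponent.image _ continuous_subtype_val.continuousOn
  · have hclos : IsClosed (⋃ b ∈ {b : closure U | (b : X) ∈ frontier U ∧ yy ∉ connectedComponent b},
        (Subtype.val '' connectedComponent b : Set X)) := by
      apply Set.Finite.isClosed_biUnion
      · exact hF.subset (fun b hb => hb.1)
      · intro b _
        exact hKc.isClosedEmbedding_subtypeVal.isClosedMap _ isClosed_connectedComponent
    refine mem_of_superset ((hU.inter hclos.isOpen_compl).mem_nhds ⟨hyU, ?_⟩) ?_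
    · intro hy
      obtain ⟨b, hb, c, hc, hcy⟩ := mem_iUnion₂.1 hy
      have : c = yy := Subtype.ext hcy
      exact hb.2 (this ▸ hc)
    · rintro p ⟨hpU, hp⟩
      obtain ⟨b, hbF, hb⟩ := key ⟨p, subset_closure hpU⟩
      have hpb : (⟨p, subset_closure hpU⟩ : closure U) ∈ connectedComponent b := by
        rw [← connectedComponent_eq hb]; exact mem_connectedComponent
      refine ⟨⟨p, subset_closure hpU⟩, ?_, rfl⟩
      by_cases hyb : yy ∈ connectedComponent b
      · rw [← connectedComponent_eq hyb]; exact hpb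
      · exact (hp (mem_iUnion₂.2 ⟨b, ⟨hbF, hyb⟩, _, hpb, rfl⟩)).elim
  · rintro _ ⟨c, _, rfl⟩
    exact hUO c.2

lemma aux_interp {X : Type*} [MetricSpace X] [CompactSpace X]
    (hX : IsRegCurve X) {K O T : Set X} (hK : IsClosed K) (hO : IsOpen O) (hKO : K ⊆ O)
    (hT : T.Finite) : ∃ V, IsOpen V ∧ K ⊆ V ∧ closure V ⊆ O ∧ (frontier V).Finite ∧
      ∀ p ∈ T, p ∉ frontier V := by
  have : ∀ y : X, ∃ U, IsOpen U ∧ y ∈ U ∧ (y ∈ O → closure U ⊆ O) ∧ (frontier U).Finite := by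
    intro y
    by_cases hy : y ∈ O
    · obtain ⟨U, h1, h2, h3, h4⟩ := aux_small hX (hO.mem_nhds hy)
      exact ⟨U, h1, h2, fun _ => h3, h4⟩
    · exact ⟨univ, isOpen_univ, mem_univ _, fun h => (hy h).elim, by simp⟩
  choose U h1 h2 h3 h4 using this
  have hc : IsCompact (K ∪ (T ∩ O)) := hK.isCompact.union (hT.inter_of_left O).isCompact
  obtain ⟨t, ht, hcov⟩ := hc.elim_nhds_subcover U (fun x _ => (h1 x).mem_nhds (h2 x))
  have hclo : closure (⋃ x ∈ t, U x) ⊆ O := by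
    rw [Finset.closure_biUnion]
    refine iUnion₂_subset fun x hx => h3 x ?_
    rcases ht x hx with h | h
    · exact hKO h
    · exact h.2
  have hop : IsOpen (⋃ x ∈ t, U x) := isOpen_biUnion fun x _ => h1 x
  refine ⟨⋃ x ∈ t, U x, hop, subset_union_left.trans hcov, hclo, ?_, ?_⟩
  · clear hcov ht hclo hop
    refine (t.finite_toSet.biUnion (fun x _ => h4 x)).subset ?_
    intro p hp
    rw [frontier, Finset.closure_biUnion] at hp
    obtain ⟨hp1, hp2⟩ := hp
    obtain ⟨x, hx, hpx⟩ := mem_iUnion₂.1 hp1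
    refine mem_iUnion₂.2 ⟨x, hx, hpx, fun h => hp2 ?_⟩
    exact interior_mono (subset_biUnion_of_mem (u := U) hx) h
  · intro p hp hpf
    have hpO := hclo hpf.1
    have := hcov (Or.inr ⟨hp, hpO⟩)
    exact hpf.2 (by rwa [hop.interior_eq])

lemma aux_iter {X : Type*} [TopologicalSpace X] {f : X → X} (hf : IsMonotoneMap f) (k : ℕ)
    {C : Set X} (hC : IsPreconnected C) : IsPreconnected (f^[k] ⁻¹' C) := by
  induction k generalizing C with
  | zero => simpa using hC
  | succ k ih =>
    rw [Function.iterate_succ', Set.preimage_comp]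
    exact ih (hf.2 C hC)

def AuxCl {X : Type*} [TopologicalSpace X] (x : ℕ → X) (w : X) : Prop :=
  ∀ O ∈ 𝓝 w, ∀ k : ℕ, ∃ n ≥ k, x n ∈ O

lemma aux_back {X : Type*} {f : X → X} {x : ℕ → X} (hx : ∀ n, f (x (n + 1)) = x n) (k n : ℕ) :
    f^[k] (x (n + k)) = x n := by
  induction k with
  | zero => rfl
  | succ k ih => rw [Function.iterate_succ_apply, ← add_assoc, hx, ih]

lemma aux_back' {X : Type*} {f : X → X} {x : ℕ → X} (hx : ∀ n, f (x (n + 1)) = x n) {k m : ℕ}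
    (h : k ≤ m) : f^[k] (x m) = x (m - k) := by
  obtain ⟨n, rfl⟩ := Nat.exists_eq_add_of_le' h
  rw [aux_back hx]; simp

lemma aux_window {X : Type*} [TopologicalSpace X] {f : X → X} (hf : Continuous f) {x : ℕ → X}
    (hx : ∀ n, f (x (n + 1)) = x n) {a : X} (ha : AuxCl x a) {U : Set X} (hU : IsOpen U)
    (haU : ∀ t, f^[t] a ∈ U) (T N0 : ℕ) : ∃ ν ≥ N0, ∀ j ≤ T, x (ν + j) ∈ U := by
  have hO : (⋂ t ∈ Finset.range (T + 1), f^[t] ⁻¹' U) ∈ 𝓝 a := by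
    rw [Filter.biInter_finset_mem]
    intro t _
    exact (hU.preimage (hf.iterate t)).mem_nhds (haU t)
  obtain ⟨n, hn, hxn⟩ := ha _ hO (N0 + T)
  refine ⟨n - T, by omega, fun j hj => ?_⟩
  have := mem_iInter₂.1 hxn (T - j) (Finset.mem_range.2 (by omega))
  rw [mem_preimage, aux_back' hx (by omega)] at this
  convert this using 2
  omega

lemma aux_count {X : Type*} {F Φ : Set X} (hF : F.Finite)
    (h : ∀ Ψ : Finset X, ↑Ψ ⊆ Φ → ∃ g : X → X, (∀ b ∈ Ψ, g b ∈ F) ∧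
      ∀ b ∈ Ψ, ∀ c ∈ Ψ, g b = g c → b = c) : Φ.Finite := by
  by_contra hinf
  obtain ⟨Ψ, hΨ, hc⟩ := Set.Infinite.exists_subset_card_eq hinf (hF.toFinset.card + 1)
  obtain ⟨g, hg, hinj⟩ := h Ψ hΨ
  obtain ⟨b, hb, c, hc', hne, he⟩ := Finset.exists_ne_map_eq_of_card_lt_of_maps_to
    (s := Ψ) (t := hF.toFinset) (f := g) (by omega) (fun b hb => by simpa using hg b hb)
  exact hne (hinj b hb c hc' he)

lemma aux_period {X : Type*} {f : X → X} {Ψ : Finset X}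
    (h : ∀ b ∈ Ψ, ∃ k ≥ 1, f^[k] b = b) : ∃ N ≥ 1, ∀ b ∈ Ψ, f^[N] b = b := by
  choose! k hk hb using h
  refine ⟨∏ b ∈ Ψ, k b, Nat.succ_le_of_lt (Finset.prod_pos fun b hb => hk b hb), fun b hb' => ?_⟩
  have : IsPeriodicPt f (k b) b := hb b hb'
  exact this.trans_dvd (Finset.dvd_prod_of_mem k hb')

lemma aux_P {X : Type*} [MetricSpace X] [CompactSpace X] [ConnectedSpace X]
    (hX : IsRegCurve X) {f : X → X} (hf : IsMonotoneMap f) {x : ℕ → X}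
    (hx : ∀ n, f (x (n + 1)) = x n) {a : X} (ha : AuxCl x a) {U : Set X} (hU : IsOpen U)
    (haU : ∀ t, f^[t] a ∈ U) (hfin : (frontier U).Finite) :
    {b | AuxCl x b ∧ b ∉ U ∧ ∃ k ≥ 1, f^[k] b = b}.Finite := by
  refine aux_count hfin fun Ψ hΨ => ?_
  obtain ⟨N, hN, hper⟩ := aux_period (f := f) (Ψ := Ψ) (fun b hb => (hΨ hb).2.2)
  obtain ⟨W, hW, hdisj⟩ := Ψ.finite_toSet.t2_separation
  have : ∀ b : X, ∃ C, IsPreconnected C ∧ C ∈ 𝓝 b ∧ C ⊆ W b := fun b =>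
    aux_locconn hX ((hW b).2.mem_nhds (hW b).1)
  choose C hC hCn hCW using this
  have : ∀ b ∈ Ψ, ∃ m, x m ∈ C b := fun b hb => by
    obtain ⟨m, _, hm⟩ := (hΨ hb).1 _ (hCn b) 0
    exact ⟨m, hm⟩
  choose! m hm using this
  obtain ⟨ν, _, hν⟩ := aux_window hf.1 hx ha hU haU (Ψ.sup m + N) 0
  set k := N * (ν / N + 1) with hk
  have hk1 : ν ≤ k ∧ k ≤ ν + N := by
    have h1 := Nat.div_add_mod ν N
    have h2 := Nat.mod_lt ν (show N > 0 by omega)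
    rw [hk, mul_add, mul_one]
    constructor <;> omega
  have : ∀ b ∈ Ψ, ∃ w ∈ f^[k] ⁻¹' (C b), w ∈ frontier U := fun b hb => by
    refine aux_cross (aux_iter hf k (hC b)) ⟨x (m b + k), ?_, ?_⟩ ⟨b, ?_, (hΨ hb).2.1⟩
    · rw [mem_preimage, aux_back hx]; exact hm b hb
    · have h1 := hν (m b + k - ν) (by have := Finset.le_sup (f := m) hb; omega)
      convert h1 using 2
      omega
    · have : IsPeriodicPt f N b := hper b hb
      have : f^[k] b = b := this.trans_dvd (dvd_mul_right _ _)
      rw [mem_preimage, this]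
      exact mem_of_mem_nhds (hCn b)
  choose! g hg1 hg2 using this
  refine ⟨g, hg2, fun b hb c hc he => ?_⟩
  by_contra hne
  have := hdisj hb hc hne
  have h1 := hCW b (hg1 b hb)
  have h2 := hCW c (hg1 c hc)
  rw [he] at h1
  exact Set.disjoint_left.1 this h1 h2

lemma aux_Theta {X : Type*} [MetricSpace X] {f : X → X} (hf : IsMonotoneMap f)
    {V : Set X} (hfin : (frontier V).Finite) :
    {q | q ∉ V ∧ ∃ k ≥ 1, f^[k] q = q ∧ ∃ v ∈ V, f^[k] v = q}.Finite := by
  refine aux_count hfin fun Ψ hΨ => ?_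
  have h1 : ∀ q ∈ Ψ, ∃ k ≥ 1, f^[k] q = q ∧ ∃ v ∈ V, f^[k] v = q := fun q hq => (hΨ hq).2
  choose! k hk hkq v hv hkv using h1
  set K := ∏ q ∈ Ψ, k q with hK
  have : ∀ q ∈ Ψ, ∃ w ∈ f^[K] ⁻¹' {q}, w ∈ frontier V := fun q hq => by
    have hp : IsPeriodicPt f (k q) q := hkq q hq
    have hd : k q ∣ K := Finset.dvd_prod_of_mem k hq
    have hKpos : 0 < K := Finset.prod_pos fun b hb => hk b hb
    refine aux_cross (aux_iter hf K isPreconnected_singleton) ⟨v q, ?_, hv q hq⟩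
      ⟨q, hp.trans_dvd hd, (hΨ hq).1⟩
    have hle : k q ≤ K := Nat.le_of_dvd hKpos hd
    have e : K = (K - k q) + k q := by omega
    rw [mem_preimage, e, Function.iterate_add_apply, hkv q hq]
    exact hp.trans_dvd (Nat.dvd_sub hd dvd_rfl)
  choose! g hg1 hg2 using this
  refine ⟨g, hg2, fun b hb c hc he => ?_⟩
  have h1 := hg1 b hb
  have h2 := hg1 c hc
  rw [mem_preimage, mem_singleton_iff] at h1 h2
  rw [← h1, ← h2, he]

lemma aux_lim {X : Type*} [TopologicalSpace X] [CompactSpace X] (F : Ultrafilter ℕ) (u : ℕ → X) :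
    ∃ y, Tendsto u F (𝓝 y) := by
  obtain ⟨y, _, hy⟩ := isCompact_univ.ultrafilter_le_nhds (F.map u) (by simp)
  exact ⟨y, hy⟩

lemma aux_exit {X : Type*} [TopologicalSpace X] {f : X → X} (hf : Continuous f) {x : ℕ → X}
    (hx : ∀ n, f (x (n + 1)) = x n) {a : X} (ha : AuxCl x a) {U : Set X} (hU : IsOpen U)
    (haU : ∀ t, f^[t] a ∈ U) (hout : ∀ k, ∃ n ≥ k, x n ∉ U) (T : ℕ) :
    ∃ m > T, x m ∉ U ∧ ∀ t, 1 ≤ t → t ≤ T → x (m - t) ∈ U := by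
  classical
  obtain ⟨ν, hν1, hν⟩ := aux_window hf hx ha hU haU T 1
  have hex := hout ν
  have h1 := Nat.find_spec hex
  have h2 : ν + T < Nat.find hex := by
    by_contra h
    push Not at h
    have := hν (Nat.find hex - ν) (by omega)
    rw [Nat.add_sub_cancel' h1.1] at this
    exact h1.2 this
  refine ⟨Nat.find hex, by omega, h1.2, fun t ht htT => ?_⟩
  by_contra h
  exact Nat.find_min hex (m := Nat.find hex - t) (by omega) ⟨by omega, h⟩

lemma aux_Q {X : Type*} [MetricSpace X] [CompactSpace X] [ConnectedSpace X]
    (hX : IsRegCurve X) {f : X → X} (hf : IsMonotoneMap f) {x : ℕ → X}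
    (hx : ∀ n, f (x (n + 1)) = x n) {a : X} (ha : AuxCl x a) {V' V0 V : Set X} (hV' : IsOpen V')
    (haV' : ∀ t, f^[t] a ∈ V')
    (hper : ∀ b, AuxCl x b → b ∈ frontier V' → ∀ k ≥ 1, f^[k] b ≠ b)
    (h01 : closure V' ⊆ V0) (hV0 : IsOpen V0) (h12 : V0 ⊆ V) (hfin : (frontier V).Finite)
    (hout : ∀ k, ∃ n ≥ k, x n ∉ V) :
    ∃ q ∈ frontier V, ∃ k ≥ 1, f^[k] q = q ∧ ∃ v ∈ V0, f^[k] v = q := by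
  have hex := aux_exit hf.1 hx ha hV' haV' (fun k => by
    obtain ⟨n, hn, hxn⟩ := hout k
    exact ⟨n, hn, fun h => hxn (h12 (h01 (subset_closure h)))⟩)
  choose m hmT hmout hmin using hex
  let F : Ultrafilter ℕ := Ultrafilter.of atTop
  have hF : (F : Filter ℕ) ≤ atTop := Ultrafilter.of_le atTop
  have hge : ∀ k, ∀ᶠ T in (F : Filter ℕ), k ≤ T := fun k => hF (eventually_ge_atTop k)
  have hyex : ∀ h : ℕ, ∃ y, Tendsto (fun T => x (m T + h)) F (𝓝 y) := fun h => aux_lim F _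
  choose y hy using hyex
  have hfy : ∀ h, f (y (h + 1)) = y h := fun h => by
    have h1 := (hf.1.tendsto (y (h + 1))).comp (hy (h + 1))
    refine tendsto_nhds_unique h1 ((hy h).congr fun T => ?_)
    simp only [Function.comp]
    rw [← add_assoc, hx]
  have hy0out : y 0 ∉ V' := by
    have := hV'.isClosed_compl.mem_of_tendsto (hy 0) (Eventually.of_forall fun T => hmout T)
    exact this
  have hy0in : ∀ t, 1 ≤ t → f^[t] (y 0) ∈ closure V' := fun t ht => by
    have h1 := ((hf.1.iterate t).tendsto (y 0)).comp (hy 0)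
    refine isClosed_closure.mem_of_tendsto h1 ((hge t).mono fun T hT => subset_closure ?_)
    have h2 := hmT T
    simp only [Function.comp, add_zero]
    rw [aux_back' hx (by omega)]
    exact hmin T t ht hT
  have hy0cl : AuxCl x (y 0) := fun O hO k => by
    obtain ⟨T, hT1, hT2⟩ := (((hy 0).eventually hO).and (hge k)).exists
    have := hmT T
    exact ⟨m T + 0, by omega, hT1⟩
  have hy0per : ∀ k ≥ 1, f^[k] (y 0) ≠ y 0 := fun k hk he => by
    refine hper (y 0) hy0cl ⟨he ▸ hy0in k hk, ?_⟩ k hk he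
    rwa [hV'.interior_eq]
  have hiter : ∀ h t, h ≤ t → f^[t] (y h) = f^[t - h] (y 0) := fun h t hht => by
    have e : t = (t - h) + h := by omega
    conv_lhs => rw [e, Function.iterate_add_apply]
    congr 1
    simpa using aux_back hfy h 0
  have hinj : ∀ h h', h < h' → y h ≠ y h' := fun h h' hlt he => by
    have h1 := hiter h h' hlt.le
    have h2 := hiter h' h' le_rfl
    rw [he, h2, Nat.sub_self] at h1
    exact hy0per (h' - h) (by omega) h1.symm
  have hc : ∀ n, x n ∉ V → ∃ q ∈ frontier V, ∀ O ∈ 𝓝 (y n), ∀ᶠ T in (F : Filter ℕ),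
      ∃ w ∈ O, f^[m T] w = q := by
    intro n hn
    by_contra! hcon
    choose! O hO hOno using hcon
    have hOO : (⋂ q ∈ frontier V, O q) ∈ 𝓝 (y n) :=
      (Filter.biInter_mem hfin).2 hO
    obtain ⟨C, hC, hCn, hCO⟩ := aux_locconn hX hOO
    have hev : ∀ᶠ T in (F : Filter ℕ), ∃ q ∈ frontier V, ∃ w ∈ C, f^[m T] w = q := by
      filter_upwards [(hy n).eventually hCn, hge n] with T hT hTn
      have hpre : IsPreconnected (f^[m T] '' C) :=
        hC.image _ (hf.1.iterate _).continuousOn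
      have hmt := hmT T
      obtain ⟨q, ⟨w, hw, hwq⟩, hq⟩ := aux_cross (V := V) hpre
        ⟨f^[m T] (y n), mem_image_of_mem _ (mem_of_mem_nhds hCn), by
          rw [hiter n (m T) (by omega)]
          exact h12 (h01 (hy0in _ (by omega)))⟩
        ⟨f^[m T] (x (m T + n)), mem_image_of_mem _ hT, by
          rw [add_comm, aux_back hx]; exact hn⟩
      exact ⟨q, hq, w, hw, hwq⟩
    obtain ⟨q, hq, hqe⟩ := (Ultrafilter.eventually_exists_mem_iff hfin).1 hev
    obtain ⟨T, hT, hT'⟩ := (hqe.and (hOno q hq)).exists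
    obtain ⟨w, hw, hwq⟩ := hT
    exact hT' w (mem_iInter₂.1 (hCO hw) q hq) hwq
  choose! Q hQ1 hQ2 using hc
  have hS : {n | x n ∉ V}.Infinite := by
    rw [Set.infinite_iff_exists_gt]
    intro k
    obtain ⟨n, hn, hxn⟩ := hout (k + 1)
    exact ⟨n, hxn, by omega⟩
  obtain ⟨n, hn, n', hn', hlt, heq⟩ := hS.exists_lt_map_eq_of_mapsTo (f := Q)
    (fun n hn => hQ1 n hn) hfin
  have hq := hQ1 n hn
  have hA := hQ2 n hn
  have hB := hQ2 n' hn'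
  rw [← heq] at hB
  set q := Q n with hqdef
  have hne := hinj n n' hlt
  -- periodicity of q
  have hqper : ∃ N ≥ 1, f^[N] q = q := by
    obtain ⟨O, hO, hyO, hclO, hOfin⟩ := aux_small hX
      (isOpen_compl_singleton.mem_nhds (show y n ∈ ({y n'} : Set X)ᶜ from hne))
    have hev : ∀ᶠ T in (F : Filter ℕ), ∃ w ∈ frontier O, f^[m T] w = q := by
      filter_upwards [hA O (hO.mem_nhds hyO), hB (closure O)ᶜ
        (isClosed_closure.isOpen_compl.mem_nhds (fun h => hclO h rfl))] with T h1 h2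
      obtain ⟨w1, hw1, e1⟩ := h1
      obtain ⟨w2, hw2, e2⟩ := h2
      obtain ⟨w, hw, hwf⟩ := aux_cross (V := O)
        (aux_iter hf (m T) (isPreconnected_singleton (x := q)))
        ⟨w1, e1, hw1⟩ ⟨w2, e2, fun h => hw2 (subset_closure h)⟩
      exact ⟨w, hwf, hw⟩
    obtain ⟨w, hw, hwe⟩ := (Ultrafilter.eventually_exists_mem_iff hOfin).1 hev
    obtain ⟨T1, hT1⟩ := hwe.exists
    obtain ⟨T2, hT2, hT2'⟩ := (hwe.and (hge (m T1))).exists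
    have := hmT T2
    refine ⟨m T2 - m T1, by omega, ?_⟩
    rw [← hT1, ← Function.iterate_add_apply, Nat.sub_add_cancel (by omega), hT2, hT1]
  obtain ⟨N, hN, hNq⟩ := hqper
  have hres : ∃ r ∈ Set.Iio N, ∀ᶠ T in (F : Filter ℕ), m T % N = r := by
    refine (Ultrafilter.eventually_exists_mem_iff (Set.finite_Iio N)).1
      (Eventually.of_forall fun T => ⟨m T % N, Nat.mod_lt _ (by omega), rfl⟩)
  obtain ⟨r, -, hr⟩ := hres
  set t := r + N * (n + 1) with ht
  have htn : n < t := by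
    have := Nat.le_mul_of_pos_left (n + 1) (show 0 < N by omega)
    omega
  have hOt : f^[t] ⁻¹' V0 ∈ 𝓝 (y n) := by
    refine (hV0.preimage (hf.1.iterate t)).mem_nhds ?_
    rw [mem_preimage, hiter n t htn.le]
    exact h01 (hy0in _ (by omega))
  obtain ⟨T, ⟨hT1, hT2⟩, hT3⟩ := (((hA _ hOt).and hr).and (hge t)).exists
  obtain ⟨w, hw, hwq⟩ := hT1
  have hmt := hmT T
  have hd : N ∣ m T - t := by
    refine (Nat.modEq_iff_dvd' (by omega)).1 ?_
    rw [ht, Nat.ModEq, Nat.add_mul_mod_self_left, ← hT2, Nat.mod_mod]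
  refine ⟨q, hq, m T - t, by omega, ?_, f^[t] w, hw, ?_⟩
  · have : IsPeriodicPt f N q := hNq
    exact this.trans_dvd hd
  · rw [← Function.iterate_add_apply, Nat.sub_add_cancel (by omega), hwq]

lemma aux_main {X : Type*} [MetricSpace X] [CompactSpace X] [ConnectedSpace X]
    (hX : IsRegCurve X) {f : X → X} (hf : IsMonotoneMap f) {x : ℕ → X}
    (hx : ∀ n, f (x (n + 1)) = x n) {A : Set X} (hA : ∀ a ∈ A, AuxCl x a) (hne : A.Nonempty)
    (hcl : IsClosed A) (hinv : f '' A ⊆ A) {z : X} (hz : AuxCl x z) : z ∈ A := by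
  by_contra hzA
  obtain ⟨a, haA⟩ := hne
  have horb : ∀ t, f^[t] a ∈ A := fun t => by
    induction t with
    | zero => exact haA
    | succ t ih => rw [Function.iterate_succ_apply']; exact hinv (mem_image_of_mem _ ih)
  obtain ⟨U0, hU0, hAU0, hU0z, hU0f, -⟩ := aux_interp hX (K := A) (O := {z}ᶜ) hcl
    isOpen_compl_singleton (fun p hp h => hzA (h ▸ hp)) Set.finite_empty
  have hΦ := aux_P hX hf hx (hA a haA) hU0 (fun t => hAU0 (horb t)) hU0f
  obtain ⟨V', hV', hUV', hV'z, hV'f, hV'Φ⟩ := aux_interp hX isClosed_closure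
    isOpen_compl_singleton hU0z hΦ
  obtain ⟨V0, hV0, hV'V0, hV0z, hV0f, -⟩ := aux_interp hX isClosed_closure
    isOpen_compl_singleton hV'z Set.finite_empty
  obtain ⟨V, hV, hV0V, hVz, hVf, hVΘ⟩ := aux_interp hX isClosed_closure
    isOpen_compl_singleton hV0z (aux_Theta hf hV0f)
  have hU0V' : U0 ⊆ V' := subset_closure.trans hUV'
  have h12 : V0 ⊆ V := subset_closure.trans hV0V
  obtain ⟨q, hq, k, hk, hkq, hv⟩ := aux_Q hX hf hx (hA a haA) hV'
    (fun t => hU0V' (hAU0 (horb t)))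
    (fun b hb hbf k hk he => hV'Φ b ⟨hb, fun h => by
      have := hbf.2
      rw [hV'.interior_eq] at this
      exact this (hU0V' h), k, hk, he⟩ hbf)
    hV'V0 hV0 h12 hVf (fun k => by
      obtain ⟨n, hn, hxn⟩ := hz (closure V)ᶜ
        (isClosed_closure.isOpen_compl.mem_nhds (fun h => hVz h rfl)) k
      exact ⟨n, hn, fun h => hxn (subset_closure h)⟩)
  refine hVΘ q ⟨fun h => ?_, k, hk, hkq, hv⟩ hq
  have := hq.2
  rw [hV.interior_eq] at this
  exact this (h12 h)

lemma aux_orbit {X : Type*} [MetricSpace X] [CompactSpace X] {f : X → X} (hf : Continuous f)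
    {G : ℕ → Set X} (hG : ∀ n, (G n).Nonempty ∧ IsCompact (G n))
    (hmap : ∀ n, f '' G (n + 1) ⊆ G n) :
    ∃ x : ℕ → X, (∀ n, x n ∈ G n) ∧ ∀ n, f (x (n + 1)) = x n := by
  choose g hg using fun n => (hG n).1
  let F : Ultrafilter ℕ := Ultrafilter.of atTop
  have hF : (F : Filter ℕ) ≤ atTop := Ultrafilter.of_le atTop
  have hge : ∀ k, ∀ᶠ T in (F : Filter ℕ), k ≤ T := fun k => hF (eventually_ge_atTop k)
  have hmem : ∀ k i, ∀ p ∈ G (i + k), f^[k] p ∈ G i := fun k => by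
    induction k with
    | zero => intro i p hp; exact hp
    | succ k ih =>
      intro i p hp
      rw [Function.iterate_succ_apply]
      exact ih i _ (hmap _ (mem_image_of_mem _ hp))
  choose x hx using fun i => aux_lim F (fun n => f^[n - i] (g n))
  refine ⟨x, fun i => ?_, fun i => ?_⟩
  · refine (hG i).2.isClosed.mem_of_tendsto (hx i) ((hge i).mono fun n hn => hmem _ _ _ ?_)
    rw [Nat.add_sub_cancel' hn]; exact hg n
  · have h1 := (hf.tendsto (x (i + 1))).comp (hx (i + 1))
    refine tendsto_nhds_unique h1 ((hx i).congr' ((hge (i + 1)).mono fun n hn => ?_))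
    simp only [Function.comp]
    rw [← Function.iterate_succ_apply' f]
    congr 2
    omega

lemma aux_limsup {X : Type*} [MetricSpace X] [CompactSpace X]
    {G : ℕ → Set X} (hdiam : Filter.Tendsto (fun n => Metric.diam (G n)) Filter.atTop (𝓝 0))
    {x : ℕ → X} (hx : ∀ n, x n ∈ G n) (w : X) : w ∈ limsupSet G ↔ AuxCl x w := by
  simp only [limsupSet, mem_iInter]
  constructor
  · intro h O hO k
    obtain ⟨ε, hε, hball⟩ := Metric.mem_nhds_iff.1 hO
    obtain ⟨K, hK⟩ := (hdiam.eventually (gt_mem_nhds (half_pos hε))).exists_forall_of_atTop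
    obtain ⟨p, hp, hpd⟩ := Metric.mem_closure_iff.1 (h (max k K)) (ε / 2) (half_pos hε)
    obtain ⟨n, hn, hpn⟩ := mem_iUnion₂.1 hp
    have hn' : max k K ≤ n := hn
    refine ⟨n, le_of_max_le_left hn', hball ?_⟩
    have h1 := hK n (le_of_max_le_right hn')
    have h2 := Metric.dist_le_diam_of_mem (Metric.isBounded_of_compactSpace (s := G n)) (hx n) hpn
    rw [Metric.mem_ball]
    calc dist (x n) w ≤ dist (x n) p + dist p w := dist_triangle _ _ _
      _ < ε := by rw [dist_comm p w]; linarith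
  · intro h k
    rw [mem_closure_iff_nhds]
    intro O hO
    obtain ⟨n, hn, hxn⟩ := h O hO k
    exact ⟨x n, hxn, mem_iUnion₂.2 ⟨n, hn, hx n⟩⟩

theorem stmt_14 {X : Type*} [MetricSpace X] [CompactSpace X] [ConnectedSpace X]
    (hX : IsRegCurve X) (f : X → X) (hf : IsMonotoneMap f) (G : ℕ → Set X)
    (hG : ∀ n, (G n).Nonempty ∧ IsCompact (G n))
    (hdiam : Filter.Tendsto (fun n => Metric.diam (G n)) Filter.atTop (𝓝 0))
    (hmap : ∀ n, f '' G (n + 1) ⊆ G n) :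
    IsMinimalSet f (limsupSet G) := by
  obtain ⟨x, hxG, hx⟩ := aux_orbit hf.1 hG hmap
  have hM := aux_limsup hdiam hxG
  refine ⟨?_, ?_, ?_, ?_⟩
  · obtain ⟨y, hy⟩ := aux_lim (Ultrafilter.of atTop) x
    refine ⟨y, (hM y).2 fun O hO k => ?_⟩
    obtain ⟨n, h1, h2⟩ := ((hy.eventually hO).and
      (Ultrafilter.of_le atTop (eventually_ge_atTop k))).exists
    exact ⟨n, h2, h1⟩
  · exact isClosed_iInter fun k => isClosed_closure
  · rintro _ ⟨w, hw, rfl⟩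
    rw [hM] at hw ⊢
    intro O hO k
    obtain ⟨n, hn, hxn⟩ := hw (f ⁻¹' O) (hf.1.continuousAt hO) (k + 1)
    obtain ⟨l, rfl⟩ := Nat.exists_eq_add_of_le' (show 1 ≤ n by omega)
    refine ⟨l, by omega, ?_⟩
    rw [mem_preimage, hx] at hxn
    exact hxn
  · intro A hAM hne hcl hinv
    refine Subset.antisymm hAM fun z hz => ?_
    exact aux_main hX hf hx (fun a ha => (hM a).1 (hAM ha)) hne hcl hinv ((hM z).1 hz)
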